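/- arXiv:2101.00726 — 2 statements merged into one kernel-verified Lean document; each statement's English description precedes it below -/
import Mathlib

section
/- For any Borel probability measure P on ℝ^d and every z ∈ ℝ^d, the distributionally robust halfspace depth decreases to the Tukey halfspace depth as the ambiguity radius shrinks: D_δ(z|P) ↓ D_0(z|P) as δ ↓ 0, where D_0(z|P) = inf_{u ∈ ℝ^d, ‖u‖=1} P({x : ⟨u, x − z⟩ ≥ 0}) is the classical Tukey halfspace depth. -/
open MeasureTheory RealInnerProductSpace
open scoped ENNReal

abbrev Ed (d : ℕ) := EuclideanSpace ℝ (Fin d)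

/-- 1-Wasserstein distance between Borel measures on `ℝ^d`. -/
noncomputable def wassersteinDist {d : ℕ} (P Q : Measure (Ed d)) : ℝ≥0∞ :=
  ⨅ (π : Measure (Ed d × Ed d)) (_ : π.map Prod.fst = P) (_ : π.map Prod.snd = Q),
    ∫⁻ p, ENNReal.ofReal ‖p.1 - p.2‖ ∂π

/-- Worst-case probability of a set over the Wasserstein ball of radius `δ` around `P`. -/
noncomputable def supProb {d : ℕ} (δ : ℝ) (P : Measure (Ed d)) (A : Set (Ed d)) : ℝ :=
  sSup {v : ℝ | ∃ Q : Measure (Ed d), IsProbabilityMeasure Q ∧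
    wassersteinDist Q P ≤ ENNReal.ofReal δ ∧ v = (Q A).toReal}

/-- Distributionally robust halfspace depth. -/
noncomputable def robustDepth {d : ℕ} (δ : ℝ) (z : Ed d) (P : Measure (Ed d)) : ℝ :=
  sInf {v : ℝ | ∃ u : Ed d, ‖u‖ = 1 ∧ v = supProb δ P {x | 0 ≤ ⟪u, x - z⟫}}

lemma wassersteinDist_self {d : ℕ} (P : Measure (Ed d)) : wassersteinDist P P = 0 := by
  have hdiag : Measurable fun x : Ed d => (x, x) := measurable_id.prodMk measurable_id
  refine le_antisymm ?_ zero_le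
  refine iInf_le_of_le (P.map fun x => (x, x)) (iInf_le_of_le ?_ (iInf_le_of_le ?_ ?_))
  · rw [Measure.map_map measurable_fst hdiag]
    exact Measure.map_id
  · rw [Measure.map_map measurable_snd hdiag]
    exact Measure.map_id
  · rw [lintegral_map (by fun_prop) hdiag]
    simp

lemma bddAbove_prob_wassersteinBall {d : ℕ} (δ : ℝ) (P : Measure (Ed d)) (A : Set (Ed d)) :
    BddAbove {v : ℝ | ∃ Q : Measure (Ed d), IsProbabilityMeasure Q ∧
      wassersteinDist Q P ≤ ENNReal.ofReal δ ∧ v = (Q A).toReal} := by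
  refine ⟨1, ?_⟩
  rintro v ⟨Q, hQ, -, rfl⟩
  exact measureReal_le_one

lemma prob_le_supProb {d : ℕ} (δ : ℝ) (P : Measure (Ed d)) [IsProbabilityMeasure P]
    (A : Set (Ed d)) : (P A).toReal ≤ supProb δ P A :=
  le_csSup (bddAbove_prob_wassersteinBall δ P A)
    ⟨P, inferInstance, by simp [wassersteinDist_self], rfl⟩

lemma supProb_nonneg {d : ℕ} (δ : ℝ) (P : Measure (Ed d)) (A : Set (Ed d)) :
    0 ≤ supProb δ P A := by
  refine Real.sSup_nonneg ?_
  rintro v ⟨Q, -, -, rfl⟩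
  exact ENNReal.toReal_nonneg

lemma supProb_mono {d : ℕ} {δ₁ δ₂ : ℝ} (h : δ₁ ≤ δ₂) (P : Measure (Ed d))
    [IsProbabilityMeasure P] (A : Set (Ed d)) : supProb δ₁ P A ≤ supProb δ₂ P A := by
  refine csSup_le_csSup (bddAbove_prob_wassersteinBall δ₂ P A)
    ⟨_, P, inferInstance, by simp [wassersteinDist_self], rfl⟩ ?_
  rintro v ⟨Q, hQ, hd, rfl⟩
  exact ⟨Q, hQ, hd.trans (ENNReal.ofReal_le_ofReal h), rfl⟩

lemma measure_halfspace_le_of_coupling {d : ℕ} (π : Measure (Ed d × Ed d)) {ε : ℝ} (hε : 0 < ε)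
    (z : Ed d) {u : Ed d} (hu : ‖u‖ = 1) :
    π.map Prod.fst {x | 0 ≤ ⟪u, x - z⟫} ≤ π.map Prod.snd {x | -ε ≤ ⟪u, x - z⟫} +
      (∫⁻ p, ENNReal.ofReal ‖p.1 - p.2‖ ∂π) / ENNReal.ofReal ε := by
  have hmeas (c : ℝ) : MeasurableSet {x : Ed d | c ≤ ⟪u, x - z⟫} :=
    measurableSet_le measurable_const (by fun_prop)
  rw [Measure.map_apply measurable_fst (hmeas 0), Measure.map_apply measurable_snd (hmeas (-ε))]
  have hmarkov := meas_ge_le_lintegral_div (μ := π)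
    (f := fun p => ENNReal.ofReal ‖p.1 - p.2‖) (by fun_prop)
    (ε := ENNReal.ofReal ε) (by simpa using hε) ENNReal.ofReal_ne_top
  refine le_trans ?_ (add_le_add_right hmarkov _)
  refine (measure_mono ?_).trans (measure_union_le _ _)
  rintro ⟨x, y⟩ hx
  simp only [Set.mem_preimage, Set.mem_ofPred_eq, Set.mem_union] at hx ⊢
  by_cases hxy : ε ≤ ‖x - y‖
  · exact Or.inr (ENNReal.ofReal_le_ofReal hxy)
  · left
    have hinner : ⟪u, x - y⟫ ≤ ‖x - y‖ := by
      simpa [hu] using real_inner_le_norm u (x - y)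
    have hsplit : ⟪u, x - z⟫ = ⟪u, x - y⟫ + ⟪u, y - z⟫ := by
      rw [← inner_add_right, sub_add_sub_cancel]
    linarith

lemma supProb_halfspace_le {d : ℕ} (P : Measure (Ed d)) [IsProbabilityMeasure P]
    {δ ε : ℝ} (hδ : 0 ≤ δ) (hε : 0 < ε) (z : Ed d) {u : Ed d} (hu : ‖u‖ = 1) :
    supProb δ P {x | 0 ≤ ⟪u, x - z⟫} ≤ (P {x | -ε ≤ ⟪u, x - z⟫}).toReal + δ / ε := by
  refine csSup_le ⟨_, P, inferInstance, by simp [wassersteinDist_self], rfl⟩ ?_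
  rintro v ⟨Q, hQ, hd, rfl⟩
  refine le_of_forall_pos_le_add fun η hη => ?_
  have hlt : wassersteinDist Q P < ENNReal.ofReal (δ + η * ε) :=
    hd.trans_lt ((ENNReal.ofReal_lt_ofReal_iff (by positivity)).2
      (lt_add_of_pos_right _ (by positivity)))
  simp only [wassersteinDist, iInf_lt_iff] at hlt
  obtain ⟨π, hQπ, hPπ, hcost⟩ := hlt
  have hbound : Q {x | 0 ≤ ⟪u, x - z⟫} ≤
      P {x | -ε ≤ ⟪u, x - z⟫} + ENNReal.ofReal ((δ + η * ε) / ε) := by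
    rw [← hQπ, ← hPπ, ENNReal.ofReal_div_of_pos hε]
    exact (measure_halfspace_le_of_coupling π hε z hu).trans
      (add_le_add_right (ENNReal.div_le_div_right hcost.le _) _)
  have hreal := ENNReal.toReal_mono (by finiteness) hbound
  rw [ENNReal.toReal_add (by finiteness) (by finiteness),
    ENNReal.toReal_ofReal (by positivity), add_div, mul_div_cancel_right₀ _ hε.ne'] at hreal
  linarith

lemma exists_pos_prob_enlarged_halfspace_lt {d : ℕ} (P : Measure (Ed d))
    [IsProbabilityMeasure P] (u z : Ed d) {a : ℝ} (ha : (P {x | 0 ≤ ⟪u, x - z⟫}).toReal < a) :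
    ∃ ε > 0, (P {x | -ε ≤ ⟪u, x - z⟫}).toReal < a := by
  have hlim : Filter.Tendsto (fun ε : ℝ => P {x | -ε ≤ ⟪u, x - z⟫}) (nhdsWithin 0 (Set.Ioi 0))
      (nhds (P (⋂ ε > (0 : ℝ), {x | -ε ≤ ⟪u, x - z⟫}))) := by
    refine tendsto_measure_biInter_gt (fun ε _ => ?_) (fun i j _ hij x hx => ?_)
      ⟨1, one_pos, measure_ne_top _ _⟩
    · exact (measurableSet_le measurable_const (by fun_prop)).nullMeasurableSet
    · exact (neg_le_neg hij).trans hx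
  have hinter : ⋂ ε > (0 : ℝ), {x | -ε ≤ ⟪u, x - z⟫} = {x | 0 ≤ ⟪u, x - z⟫} := by
    ext x
    simp only [Set.mem_iInter, Set.mem_ofPred_eq]
    refine ⟨fun h => le_of_forall_pos_le_add fun ε hε => ?_, fun h ε hε => ?_⟩
    · linarith [h ε hε]
    · linarith
  rw [hinter] at hlim
  have hev := ((ENNReal.tendsto_toReal (measure_ne_top P _)).comp hlim).eventually_lt_const ha
  obtain ⟨ε, hlt, hε⟩ := (hev.and self_mem_nhdsWithin).exists
  exact ⟨ε, hε, hlt⟩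

lemma robustDepth_eq_iInf {d : ℕ} (δ : ℝ) (z : Ed d) (P : Measure (Ed d)) :
    robustDepth δ z P = ⨅ u : {u : Ed d // ‖u‖ = 1}, supProb δ P {x | 0 ≤ ⟪u.1, x - z⟫} := by
  simp only [robustDepth, iInf, Set.range, Subtype.exists, exists_prop, eq_comm]

lemma bddBelow_range_supProb {d : ℕ} (δ : ℝ) (z : Ed d) (P : Measure (Ed d)) :
    BddBelow (Set.range fun u : {u : Ed d // ‖u‖ = 1} =>
      supProb δ P {x | 0 ≤ ⟪u.1, x - z⟫}) := by
  refine ⟨0, ?_⟩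
  rintro _ ⟨u, rfl⟩
  exact supProb_nonneg _ _ _

/-- **Tukey depth approximation.** For every `z`, `D_δ(z|P)` decreases to the classical
Tukey halfspace depth `D_0(z|P) = inf_{‖u‖=1} P(⟪u, x - z⟫ ≥ 0)` as `δ ↓ 0`:
it is monotone in `δ`, bounded below by `D_0(z|P)`, and converges to it as `δ ↓ 0`. -/
theorem robustDepth_tendsto_tukeyDepth {d : ℕ} (P : Measure (Ed d)) [IsProbabilityMeasure P]
    (z : Ed d) (D0 : ℝ)
    (hD0 : D0 = sInf {v : ℝ | ∃ u : Ed d, ‖u‖ = 1 ∧ v = (P {x | 0 ≤ ⟪u, x - z⟫}).toReal}) :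
    (∀ δ₁ δ₂ : ℝ, 0 < δ₁ → δ₁ ≤ δ₂ → robustDepth δ₁ z P ≤ robustDepth δ₂ z P) ∧
    (∀ δ : ℝ, 0 < δ → D0 ≤ robustDepth δ z P) ∧
    Filter.Tendsto (fun δ => robustDepth δ z P) (nhdsWithin 0 (Set.Ioi 0)) (nhds D0) := by
  have hD0' : D0 = ⨅ u : {u : Ed d // ‖u‖ = 1}, (P {x | 0 ≤ ⟪u.1, x - z⟫}).toReal := by
    simp only [hD0, iInf, Set.range, Subtype.exists, exists_prop, eq_comm]
  have hbdd : BddBelow (Set.range fun u : {u : Ed d // ‖u‖ = 1} =>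
      (P {x | 0 ≤ ⟪u.1, x - z⟫}).toReal) := by
    refine ⟨0, ?_⟩
    rintro _ ⟨u, rfl⟩
    exact ENNReal.toReal_nonneg
  have hlower (δ : ℝ) : D0 ≤ robustDepth δ z P := by
    rw [hD0', robustDepth_eq_iInf]
    exact ciInf_mono hbdd fun u => prob_le_supProb δ P _
  refine ⟨fun δ₁ δ₂ _ h => ?_, fun δ _ => hlower δ, tendsto_order.2
    ⟨fun a ha => .of_forall fun δ => ha.trans_le (hlower δ), fun a ha => ?_⟩⟩
  · rw [robustDepth_eq_iInf, robustDepth_eq_iInf]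
    exact ciInf_mono (bddBelow_range_supProb δ₁ z P) fun u => supProb_mono h P _
  · rcases isEmpty_or_nonempty {u : Ed d // ‖u‖ = 1} with hempty | hne
    · refine .of_forall fun δ => ?_
      rw [hD0', Real.iInf_of_isEmpty] at ha
      rwa [robustDepth_eq_iInf, Real.iInf_of_isEmpty]
    · rw [hD0'] at ha
      obtain ⟨u, hu⟩ := exists_lt_of_ciInf_lt ha
      obtain ⟨ε, hε, hlt⟩ := exists_pos_prob_enlarged_halfspace_lt P u.1 z hu
      have hlim : Filter.Tendsto
          (fun δ : ℝ => (P {x | -ε ≤ ⟪u.1, x - z⟫}).toReal + δ / ε) (nhdsWithin 0 (Set.Ioi 0))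
          (nhds ((P {x | -ε ≤ ⟪u.1, x - z⟫}).toReal + 0 / ε)) :=
        (Continuous.tendsto (by fun_prop) 0).mono_left nhdsWithin_le_nhds
      rw [zero_div, add_zero] at hlim
      filter_upwards [hlim.eventually_lt_const hlt, self_mem_nhdsWithin] with δ hδ hpos
      rw [robustDepth_eq_iInf]
      exact ((ciInf_le (bddBelow_range_supProb δ z P) u).trans
        (supProb_halfspace_le P (le_of_lt hpos) hε z u.2)).trans_lt hδ
end

section
/- Let P = ½ δ_{(1,1)} + ½ δ_{(1,−1)} be the probability measure on ℝ² placing mass ½ at each of the points (1,1) and (1,−1), and let δ ∈ (0, 1/2). Then sup_{P' : d_W(P',P) ≤ δ} inf_{u ∈ ℝ², ‖u‖=1} P'({x : ⟨u, x⟩ ≥ 0}) = δ/√2, which is strictly smaller than D_δ(0|P) = δ; in particular the maximin value is strictly below the minimax value. -/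
open MeasureTheory RealInnerProductSpace
open scoped ENNReal

/-- A function that at every `x` is at most the transport cost from `x` to either atom of a
two-point measure has integral at most the Wasserstein distance to that measure. -/
lemma lintegral_le_wassersteinDist_two_dirac {d : ℕ} {y z : Ed d} {c c' : ℝ≥0∞}
    (Q : Measure (Ed d)) {f : Ed d → ℝ≥0∞} (hf : Measurable f)
    (hy : ∀ x, f x ≤ ENNReal.ofReal ‖x - y‖) (hz : ∀ x, f x ≤ ENNReal.ofReal ‖x - z‖) :
    ∫⁻ x, f x ∂Q ≤ wassersteinDist Q (c • Measure.dirac y + c' • Measure.dirac z) := by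
  refine le_iInf fun π => le_iInf fun h₁ => le_iInf fun h₂ => ?_
  have hae : ∀ᵐ p ∂π, p.2 = y ∨ p.2 = z := by
    refine ae_of_ae_map (p := fun x => x = y ∨ x = z) measurable_snd.aemeasurable ?_
    rw [h₂, ae_add_measure_iff]
    constructor
    · exact Measure.ae_smul_measure (by simp [ae_dirac_eq]) c
    · exact Measure.ae_smul_measure (by simp [ae_dirac_eq]) c'
  rw [← h₁, lintegral_map hf measurable_fst]
  refine lintegral_mono_ae ?_
  filter_upwards [hae] with p hp
  rcases hp with hp | hp
  · simpa [hp] using hy p.1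
  · simpa [hp] using hz p.1

/-- Moving mass `m ≤ 1/2` from an atom `y` of `½δ_y + ½δ_z` to a point `w`. -/
lemma exists_wassersteinDist_le_of_move_mass {d : ℕ} (y z w : Ed d) {m δ : ℝ} (hm₀ : 0 ≤ m)
    (hm₁ : m ≤ 1 / 2) (hδ : m * ‖w - y‖ ≤ δ) :
    ∃ Q : Measure (Ed d), IsProbabilityMeasure Q ∧
      wassersteinDist Q ((2 : ℝ≥0∞)⁻¹ • Measure.dirac y + (2 : ℝ≥0∞)⁻¹ • Measure.dirac z) ≤
        ENNReal.ofReal δ ∧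
      ∀ A : Set (Ed d), w ∈ A → ENNReal.ofReal m ≤ Q A := by
  have hhalf : ENNReal.ofReal m + ENNReal.ofReal (1 / 2 - m) = (2 : ℝ≥0∞)⁻¹ := by
    rw [← ENNReal.ofReal_add hm₀ (by linarith), add_sub_cancel, one_div,
      ENNReal.ofReal_inv_of_pos two_pos, ENNReal.ofReal_ofNat]
  refine ⟨ENNReal.ofReal m • Measure.dirac w + ENNReal.ofReal (1 / 2 - m) • Measure.dirac y
    + (2 : ℝ≥0∞)⁻¹ • Measure.dirac z, ⟨?_⟩, ?_, ?_⟩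
  · simp only [Measure.add_apply, Measure.smul_apply, measure_univ, smul_eq_mul, mul_one]
    rw [hhalf, ENNReal.inv_two_add_inv_two]
  · refine iInf_le_of_le (ENNReal.ofReal m • Measure.dirac (w, y)
      + ENNReal.ofReal (1 / 2 - m) • Measure.dirac (y, y)
      + (2 : ℝ≥0∞)⁻¹ • Measure.dirac (z, z)) (iInf_le_of_le ?_ (iInf_le_of_le ?_ ?_))
    · simp [Measure.map_add, Measure.map_smul, measurable_fst]
    · simp only [Measure.map_add _ _ measurable_snd, Measure.map_smul, Measure.map_dirac]
      rw [← add_smul, hhalf]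
    · simp only [lintegral_add_measure, lintegral_smul_measure, lintegral_dirac, sub_self,
        norm_zero, ENNReal.ofReal_zero, smul_eq_mul, mul_zero, add_zero]
      rw [← ENNReal.ofReal_mul hm₀]
      exact ENNReal.ofReal_le_ofReal hδ
  · intro A hA
    simp only [Measure.add_apply, Measure.smul_apply, smul_eq_mul, add_assoc]
    exact le_add_right (by simp [Measure.dirac_apply_of_mem hA])

/-- For `s ∈ [-√2/2, √2/2]`, the `s` whose halfspace `s q ≥ √(1 - s²) p` contains `(p, q)` form a
set of length at most the distance from `(p, q)` to `(1, 1)`. -/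
lemma volume_halfspace_parameters_le (p q : ℝ) :
    volume ({s : ℝ | 0 ≤ s * q - √(1 - s ^ 2) * p} ∩ Set.Icc (-(√2 / 2)) (√2 / 2)) ≤
      ENNReal.ofReal √((p - 1) ^ 2 + (q - 1) ^ 2) := by
  have hr₀ : 0 < √2 / 2 := by positivity
  have hr₂ : (√2 / 2) ^ 2 = 1 / 2 := by
    rw [div_pow, Real.sq_sqrt (by norm_num)]; norm_num
  set r := √2 / 2
  have hk : ∀ s ∈ Set.Icc (-r) r, (√(1 - s ^ 2)) ^ 2 = 1 - s ^ 2 := fun s hs =>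
    Real.sq_sqrt (by nlinarith [hs.1, hs.2])
  rcases le_or_gt (p + q) 0 with hpq | hpq
  · refine (measure_mono Set.inter_subset_right).trans ?_
    rw [Real.volume_Icc]
    refine ENNReal.ofReal_le_ofReal (Real.le_sqrt_of_sq_le ?_)
    nlinarith [sq_nonneg p, sq_nonneg q]
  have hn : 0 < p ^ 2 + q ^ 2 := by nlinarith [sq_nonneg (p - q), sq_nonneg (p + q)]
  set ρ := √(p ^ 2 + q ^ 2)
  have hρ₀ : 0 < ρ := Real.sqrt_pos.2 hn
  have hρ₂ : ρ ^ 2 = p ^ 2 + q ^ 2 := Real.sq_sqrt hn.le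
  obtain ⟨c, hc⟩ : ∃ c, p = ρ * c := ⟨p / ρ, by field_simp⟩
  obtain ⟨σ, hσ⟩ : ∃ σ, q = ρ * σ := ⟨q / ρ, by field_simp⟩
  have hcσ : c ^ 2 + σ ^ 2 = 1 := by
    have : ρ ^ 2 * (c ^ 2 + σ ^ 2) = ρ ^ 2 * 1 := by
      rw [hc, hσ] at hρ₂; linarith
    exact mul_left_cancel₀ (by positivity) this
  have hsum : 0 < c + σ := by
    rw [hc, hσ, ← mul_add] at hpq; exact pos_of_mul_pos_right hpq hρ₀.le
  have hmem : ∀ s, 0 ≤ s * q - √(1 - s ^ 2) * p → √(1 - s ^ 2) * c ≤ s * σ := by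
    intro s hs
    have : 0 ≤ ρ * (s * σ - √(1 - s ^ 2) * c) := by rw [hc, hσ] at hs; linarith
    linarith [nonneg_of_mul_nonneg_right this hρ₀]
  clear_value ρ r
  rcases lt_or_ge σ 0 with hσ₀ | hσ₀
  · have hempty : {s : ℝ | 0 ≤ s * q - √(1 - s ^ 2) * p} ∩ Set.Icc (-r) r = ∅ := by
      refine Set.eq_empty_of_forall_notMem fun s hs => ?_
      have h := hmem s hs.1
      have hk₂ := hk s hs.2
      have hk₀ := Real.sqrt_nonneg (1 - s ^ 2)
      set k := √(1 - s ^ 2)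
      have h2 : (k * c) ^ 2 ≤ (s * σ) ^ 2 := pow_le_pow_left₀ (by nlinarith) h 2
      have hs2 : s ^ 2 ≤ 1 / 2 := by nlinarith [hs.2.1, hs.2.2]
      have hc2 : 1 / 2 < c ^ 2 := by nlinarith
      nlinarith
    rw [hempty, measure_empty]
    exact zero_le
  · have hsub : {s : ℝ | 0 ≤ s * q - √(1 - s ^ 2) * p} ∩ Set.Icc (-r) r ⊆ Set.Icc c r := by
      refine fun s hs => ⟨?_, hs.2.2⟩
      have h := hmem s hs.1
      have hk₂ := hk s hs.2
      have hk₀ := Real.sqrt_nonneg (1 - s ^ 2)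
      set k := √(1 - s ^ 2)
      by_contra! hsc
      rcases lt_or_ge 0 c with hc₀ | hc₀
      · have h2 : (k * c) ^ 2 ≤ (s * σ) ^ 2 := pow_le_pow_left₀ (by positivity) h 2
        have hs₀ : 0 ≤ s := by
          by_contra! hs₀
          have hs2 : s ^ 2 ≤ 1 / 2 := by nlinarith [hs.2.1, hs.2.2]
          have hkpos : 0 < k := by
            refine hk₀.lt_of_ne fun h0 => ?_
            rw [← h0] at hk₂
            nlinarith
          nlinarith [mul_pos hkpos hc₀]
        nlinarith
      · have h2 : (-(s * σ)) ^ 2 ≤ (-(k * c)) ^ 2 :=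
          pow_le_pow_left₀ (by nlinarith) (by linarith) 2
        nlinarith
    refine (measure_mono hsub).trans ?_
    rw [Real.volume_Icc]
    refine ENNReal.ofReal_le_ofReal ?_
    rcases le_or_gt r c with hrc | hrc
    · exact (sub_nonpos.2 hrc).trans (Real.sqrt_nonneg _)
    have hσr : r ≤ σ := by
      by_contra! h
      have h1 : σ ^ 2 < 1 / 2 := by nlinarith
      nlinarith
    refine (by linarith : r - c ≤ σ - c).trans (Real.le_sqrt_of_sq_le ?_)
    have hproj : σ - c = σ * (1 - p) - c * (1 - q) := by rw [hc, hσ]; ring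
    rw [hproj]
    nlinarith [sq_nonneg (c * (1 - p) + σ * (1 - q))]

/-- The unit vector `(-√(1 - s²), s)`. -/
noncomputable def leftUnit (s : ℝ) : Ed 2 := !₂[-√(1 - s ^ 2), s]

lemma continuous_leftUnit : Continuous leftUnit := by
  unfold leftUnit
  fun_prop

lemma norm_leftUnit {s : ℝ} (hs : s ^ 2 ≤ 1) : ‖leftUnit s‖ = 1 := by
  rw [EuclideanSpace.norm_eq, Real.sqrt_eq_one]
  simp [leftUnit, Fin.sum_univ_two, Real.sq_sqrt (sub_nonneg.2 hs)]

lemma inner_leftUnit (s : ℝ) (x : Ed 2) :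
    ⟪leftUnit s, x⟫ = s * x 1 - √(1 - s ^ 2) * x 0 := by
  simp [leftUnit, PiLp.inner_apply, Fin.sum_univ_two]
  ring

lemma norm_sub_toLp_two (x : Ed 2) (v w : ℝ) :
    ‖x - !₂[v, w]‖ = √((x 0 - v) ^ 2 + (x 1 - w) ^ 2) := by
  simp [EuclideanSpace.norm_eq, Fin.sum_univ_two]

lemma volume_leftUnit_le_upper (x : Ed 2) :
    volume.restrict (Set.Icc (-(√2 / 2)) (√2 / 2)) {s | 0 ≤ ⟪leftUnit s, x⟫} ≤
      ENNReal.ofReal ‖x - !₂[1, 1]‖ := by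
  rw [Measure.restrict_apply' measurableSet_Icc, norm_sub_toLp_two]
  simpa only [inner_leftUnit] using volume_halfspace_parameters_le (x 0) (x 1)

lemma volume_leftUnit_le_lower (x : Ed 2) :
    volume.restrict (Set.Icc (-(√2 / 2)) (√2 / 2)) {s | 0 ≤ ⟪leftUnit s, x⟫} ≤
      ENNReal.ofReal ‖x - !₂[1, -1]‖ := by
  rw [Measure.restrict_apply' measurableSet_Icc, norm_sub_toLp_two,
    ← Measure.measure_preimage_neg]
  have h := volume_halfspace_parameters_le (x 0) (-x 1)
  have hsq : (x 1 - -1) ^ 2 = (-x 1 - 1) ^ 2 := by ring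
  rw [hsq]
  convert h using 2
  ext s
  simp only [inner_leftUnit, Set.preimage_inter, Set.mem_inter_iff, Set.mem_preimage,
    Set.mem_ofPred_eq, Set.mem_Icc, neg_sq, neg_mul, mul_neg, neg_le_neg_iff, neg_le (b := s),
    and_comm (a := s ≤ √2 / 2)]

/-- The halfspace depth of the origin is at most `1/√2` times the distance to `P`. -/
lemma sInf_halfspace_le (Q : Measure (Ed 2)) [IsProbabilityMeasure Q] {δ : ℝ} (hδ : 0 ≤ δ)
    {c c' : ℝ≥0∞}
    (hQ : wassersteinDist Q (c • Measure.dirac !₂[1, 1] + c' • Measure.dirac !₂[1, -1]) ≤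
      ENNReal.ofReal δ) :
    sInf {w : ℝ | ∃ u : Ed 2, ‖u‖ = 1 ∧ w = (Q {x | 0 ≤ ⟪u, x⟫}).toReal} ≤ δ / √2 := by
  set I := sInf {w : ℝ | ∃ u : Ed 2, ‖u‖ = 1 ∧ w = (Q {x | 0 ≤ ⟪u, x⟫}).toReal}
  set J := Set.Icc (-(√2 / 2)) (√2 / 2) with hJ
  have hT : MeasurableSet {p : Ed 2 × ℝ | 0 ≤ ⟪leftUnit p.2, p.1⟫} :=
    (isClosed_le continuous_const
      ((continuous_leftUnit.comp continuous_snd).inner continuous_fst)).measurableSet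
  have hle : ∀ s ∈ J, ENNReal.ofReal I ≤ Q {x | 0 ≤ ⟪leftUnit s, x⟫} := by
    intro s hs
    have hs2 : s ^ 2 ≤ 1 := by
      have := Real.sq_sqrt (show (0 : ℝ) ≤ 2 by norm_num)
      nlinarith [hs.1, hs.2]
    refine ENNReal.ofReal_le_of_le_toReal (csInf_le ⟨0, ?_⟩ ⟨_, norm_leftUnit hs2, rfl⟩)
    rintro _ ⟨u, -, rfl⟩
    exact ENNReal.toReal_nonneg
  have hcost : ENNReal.ofReal I * ENNReal.ofReal √2 ≤ ENNReal.ofReal δ := calc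
    ENNReal.ofReal I * ENNReal.ofReal √2 = ∫⁻ _ in J, ENNReal.ofReal I := by
      rw [setLIntegral_const, hJ, Real.volume_Icc]; congr 2; ring
    _ ≤ ∫⁻ s in J, Q {x | 0 ≤ ⟪leftUnit s, x⟫} := setLIntegral_mono' measurableSet_Icc hle
    _ = ∫⁻ x, volume.restrict J {s | 0 ≤ ⟪leftUnit s, x⟫} ∂Q := by
      exact (Measure.prod_apply_symm hT).symm.trans (Measure.prod_apply hT)
    _ ≤ _ := lintegral_le_wassersteinDist_two_dirac Q (measurable_measure_prodMk_left hT)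
      volume_leftUnit_le_upper volume_leftUnit_le_lower
    _ ≤ _ := hQ
  rw [le_div_iff₀ (by positivity)]
  rw [← ENNReal.ofReal_mul' (by positivity)] at hcost
  exact (ENNReal.ofReal_le_ofReal_iff hδ).1 hcost

/-- A point within distance `r` of the halfspace `⟪u, ·⟫ ≥ 0` can be moved into it. -/
lemma exists_mem_halfspace_norm_sub_le {d : ℕ} {u y : Ed d} (hu : ‖u‖ = 1) {r : ℝ} (hr : 0 ≤ r)
    (h : -r ≤ ⟪u, y⟫) : ∃ w : Ed d, 0 ≤ ⟪u, w⟫ ∧ ‖w - y‖ ≤ r := by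
  refine ⟨y + r • u, ?_, ?_⟩
  · rw [inner_add_right, inner_smul_right, real_inner_self_eq_norm_sq, hu]; linarith
  · simp [norm_smul, hu, abs_of_nonneg hr]

lemma le_supProb {d : ℕ} {δ m : ℝ} {P : Measure (Ed d)} {A : Set (Ed d)} (Q : Measure (Ed d))
    [IsProbabilityMeasure Q] (hQ : wassersteinDist Q P ≤ ENNReal.ofReal δ)
    (hm : ENNReal.ofReal m ≤ Q A) : m ≤ supProb δ P A := by
  refine le_csSup_of_le ⟨1, ?_⟩ ⟨Q, inferInstance, hQ, rfl⟩
    ((ENNReal.ofReal_le_iff_le_toReal (measure_ne_top Q A)).1 hm)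
  rintro _ ⟨R, hR, -, rfl⟩
  exact ENNReal.toReal_le_of_le_ofReal zero_le_one (by simpa using prob_le_one)

/-- **Maximin is strictly below minimax.** For `P = ½δ_{(1,1)} + ½δ_{(1,-1)}` on `ℝ²` and
`δ ∈ (0, 1/2)`, the maximin value `sup_{d_W(P',P) ≤ δ} inf_{‖u‖=1} P'(⟪u,x⟫ ≥ 0)` equals
`δ/√2`, while the (minimax) robust depth `D_δ(0|P)` equals `δ`; in particular the maximin
value is strictly smaller. -/
theorem maximin_lt_minimax (δ : ℝ) (hδ₀ : 0 < δ) (hδ₁ : δ < 1 / 2)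
    (a b : Ed 2) (ha : a = (EuclideanSpace.equiv (Fin 2) ℝ).symm ![1, 1])
    (hb : b = (EuclideanSpace.equiv (Fin 2) ℝ).symm ![1, -1])
    (P : Measure (Ed 2))
    (hP : P = (2 : ℝ≥0∞)⁻¹ • Measure.dirac a + (2 : ℝ≥0∞)⁻¹ • Measure.dirac b)
    (maximin : ℝ)
    (hmm : maximin = sSup {v : ℝ | ∃ Q : Measure (Ed 2), IsProbabilityMeasure Q ∧
      wassersteinDist Q P ≤ ENNReal.ofReal δ ∧
      v = sInf {w : ℝ | ∃ u : Ed 2, ‖u‖ = 1 ∧ w = (Q {x | 0 ≤ ⟪u, x⟫}).toReal}}) :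
    maximin = δ / Real.sqrt 2 ∧ robustDepth δ 0 P = δ ∧ maximin < robustDepth δ 0 P := by
  have ha' : a = !₂[1, 1] := ha
  have hb' : b = !₂[1, -1] := hb
  have hsqrt : 1 < √2 := Real.lt_sqrt_of_sq_lt (by norm_num)
  have hP' : P = (2 : ℝ≥0∞)⁻¹ • Measure.dirac b + (2 : ℝ≥0∞)⁻¹ • Measure.dirac a := by
    rw [hP, add_comm]
  have hlt : δ / √2 < δ := div_lt_self hδ₀ hsqrt
  have hmaximin : maximin = δ / √2 := by
    obtain ⟨Q, hQ, hQP, hQA⟩ := exists_wassersteinDist_le_of_move_mass a b 0 (m := δ / √2) (δ := δ)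
      (by positivity) (by linarith) (by
        have : ‖(0 : Ed 2) - a‖ = √2 := by
          rw [ha', norm_sub_toLp_two]; norm_num
        rw [this, div_mul_cancel₀ _ (by positivity)])
    rw [← hP] at hQP
    have hub : ∀ v ∈ {v : ℝ | ∃ Q : Measure (Ed 2), IsProbabilityMeasure Q ∧
        wassersteinDist Q P ≤ ENNReal.ofReal δ ∧
        v = sInf {w : ℝ | ∃ u : Ed 2, ‖u‖ = 1 ∧ w = (Q {x | 0 ≤ ⟪u, x⟫}).toReal}},
        v ≤ δ / √2 := by
      rintro _ ⟨R, hR, hRP, rfl⟩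
      rw [hP, ha', hb'] at hRP
      exact sInf_halfspace_le R hδ₀.le hRP
    rw [hmm]
    refine le_antisymm (csSup_le ⟨_, Q, hQ, hQP, rfl⟩ hub)
      (le_csSup_of_le ⟨_, hub⟩ ⟨Q, hQ, hQP, rfl⟩ (le_csInf ?_ ?_))
    · exact ⟨_, leftUnit 0, norm_leftUnit (by norm_num), rfl⟩
    · rintro _ ⟨u, -, rfl⟩
      exact (ENNReal.ofReal_le_iff_le_toReal (measure_ne_top _ _)).1 (hQA _ (by simp))
  have hdepth : robustDepth δ 0 P = δ := by
    have hlb : ∀ v ∈ {v : ℝ | ∃ u : Ed 2, ‖u‖ = 1 ∧ v = supProb δ P {x | 0 ≤ ⟪u, x - 0⟫}},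
        δ ≤ v := by
      rintro _ ⟨u, hu, rfl⟩
      have hmove : ∀ y z : Ed 2,
          P = (2 : ℝ≥0∞)⁻¹ • Measure.dirac y + (2 : ℝ≥0∞)⁻¹ • Measure.dirac z →
          -1 ≤ ⟪u, y⟫ → δ ≤ supProb δ P {x | 0 ≤ ⟪u, x - 0⟫} := by
        intro y z hPyz huy
        obtain ⟨w, hw, hwy⟩ := exists_mem_halfspace_norm_sub_le hu zero_le_one huy
        obtain ⟨Q, hQ, hQP, hQA⟩ := exists_wassersteinDist_le_of_move_mass y z w hδ₀.le hδ₁.le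
          (mul_le_of_le_one_right hδ₀.le hwy)
        exact le_supProb Q (hPyz ▸ hQP) (hQA _ (by simpa using hw))
      have hnorm : u 0 ^ 2 + u 1 ^ 2 = 1 := by
        simpa [EuclideanSpace.norm_eq, Fin.sum_univ_two] using hu
      have hua : ⟪u, a⟫ = u 0 + u 1 := by
        simp [ha', PiLp.inner_apply, Fin.sum_univ_two]
      have hub : ⟪u, b⟫ = u 0 - u 1 := by
        simp [hb', PiLp.inner_apply, Fin.sum_univ_two]; ring
      rcases le_total 0 (u 1) with h | h
      · exact hmove a b hP (by rw [hua]; nlinarith)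
      · exact hmove b a hP' (by rw [hub]; nlinarith)
    have hmem := norm_leftUnit (s := 0) (by norm_num)
    refine le_antisymm ((csInf_le ⟨δ, hlb⟩ ⟨_, hmem, rfl⟩).trans ?_)
      (le_csInf ⟨_, _, hmem, rfl⟩ hlb)
    have hA : MeasurableSet {x : Ed 2 | 0 ≤ ⟪leftUnit 0, x - 0⟫} :=
      (isClosed_le continuous_const (by fun_prop)).measurableSet
    have hind : ∀ t : ℝ, ∀ x : Ed 2,
        ({x : Ed 2 | 0 ≤ ⟪leftUnit 0, x - 0⟫}.indicator 1 x : ℝ≥0∞) ≤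
          ENNReal.ofReal ‖x - !₂[1, t]‖ := by
      intro t x
      refine Set.indicator_apply_le' (fun hx => ?_) (fun _ => zero_le)
      have hx : x 0 ≤ 0 := by simpa [inner_leftUnit] using hx
      rw [Pi.one_apply, ENNReal.one_le_ofReal, norm_sub_toLp_two]
      exact Real.le_sqrt_of_sq_le (by nlinarith [sq_nonneg (x 1 - t)])
    refine Real.sSup_le ?_ hδ₀.le
    rintro _ ⟨R, hR, hRP, rfl⟩
    refine ENNReal.toReal_le_of_le_ofReal hδ₀.le (le_trans ?_ hRP)
    rw [← lintegral_indicator_one hA, hP, ha', hb']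
    exact lintegral_le_wassersteinDist_two_dirac R (measurable_one.indicator hA)
      (hind 1) (hind (-1))
  exact ⟨hmaximin, hdepth, by rw [hmaximin, hdepth]; exact hlt⟩
end
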